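/- Let 𝓜 be a nonempty subset of 𝔖 bounded from below. (i) Every extreme point of the convex set 𝔏(𝓜) is a maximal element of 𝔏(𝓜). (ii) If M is a maximal element of 𝔏(𝓜) such that the closure of ∑_{A ∈ 𝓜} ker(A−M) equals 𝓗, then M is an extreme point of 𝔏(𝓜). -/

import Mathlib

noncomputable section

variable {H : Type*} [NormedAddCommGroup H] [InnerProductSpace ℂ H] [CompleteSpace H]

/-- The (real) value `(Su, u)` of the quadratic form of a bounded operator `S`
(for self-adjoint `S` the inner product `⟪Su, u⟫` is real, and equals this value). -/
def qform (S : H →L[ℂ] H) (u : H) : ℝ := (inner ℂ (S u) u : ℂ).re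

/-- Löwner's partial order on bounded self-adjoint operators:
`S ≤ T` iff `(Su,u) ≤ (Tu,u)` for all `u ∈ H`. -/
def LoewnerLE (S T : H →L[ℂ] H) : Prop := ∀ u : H, qform S u ≤ qform T u

/-- The set `𝔏(𝓜)` of lower bounds of `M` within the bounded self-adjoint operators. -/
def lowerBoundsSA (M : Set (H →L[ℂ] H)) : Set (H →L[ℂ] H) :=
  {L | IsSelfAdjoint L ∧ ∀ A ∈ M, LoewnerLE L A}

/-- `G` is the greatest element of the set `L` with respect to Löwner's order. -/
def IsGreatestSA (L : Set (H →L[ℂ] H)) (G : H →L[ℂ] H) : Prop :=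
  G ∈ L ∧ ∀ X ∈ L, LoewnerLE X G

/-- `M` is a maximal element of the set `L` with respect to Löwner's order. -/
def IsMaximalSA (L : Set (H →L[ℂ] H)) (M : H →L[ℂ] H) : Prop :=
  M ∈ L ∧ ∀ X ∈ L, LoewnerLE M X → X = M

lemma qform_sub (S T : H →L[ℂ] H) (u : H) : qform (S - T) u = qform S u - qform T u := by
  simp [qform, inner_sub_left]

/-- A positive operator whose quadratic form vanishes at `u` annihilates `u`. -/
lemma apply_eq_zero_of_qform (S : H →L[ℂ] H) (hS : IsSelfAdjoint S)
    (hpos : ∀ u, 0 ≤ qform S u) (u : H) (hu : qform S u = 0) : S u = 0 := by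
  have hsymm := ContinuousLinearMap.isSelfAdjoint_iff_isSymmetric.mp hS
  have key : ∀ t : ℝ, qform S (u + (t : ℂ) • S u)
      = qform S u + 2 * t * ‖S u‖ ^ 2 + t ^ 2 * qform S (S u) := by
    intro t
    have h1 : inner ℂ (S (S u)) u = inner ℂ (S u) (S u) := hsymm (S u) u
    have h2 : (inner ℂ (S u) (S u) : ℂ) = ((‖S u‖ ^ 2 : ℝ) : ℂ) := by
      rw [inner_self_eq_norm_sq_to_K]; norm_cast
    simp only [qform, map_add, map_smul, inner_add_left, inner_add_right, inner_smul_left,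
      inner_smul_right, h1, h2, Complex.conj_ofReal, Complex.add_re, Complex.re_ofReal_mul,
      Complex.ofReal_re]
    ring
  have hb := hpos (S u)
  set b := qform S (S u)
  have h := hpos (u + ((-(‖S u‖ ^ 2) / (b + 1) : ℝ) : ℂ) • S u)
  rw [key, hu] at h
  set a := ‖S u‖ ^ 2 with ha
  have hb1 : 0 < b + 1 := by linarith
  have h3 : 0 + 2 * (-a / (b + 1)) * a + (-a / (b + 1)) ^ 2 * b
      = -(a ^ 2 * (b + 2)) / (b + 1) ^ 2 := by
    field_simp; ring
  rw [h3, le_div_iff₀ (by positivity)] at h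
  have h4 : a ^ 2 = 0 := by nlinarith [sq_nonneg a, mul_nonneg (sq_nonneg a) hb]
  have h5 : ‖S u‖ = 0 := by
    have : a = 0 := by simpa using h4
    simpa [ha] using this
  simpa using h5

/-- Theorem 4.4: (i) every extreme point of the convex set `𝔏(M)` is a maximal element of
`𝔏(M)`; (ii) a maximal element `Mo` of `𝔏(M)` for which the closure of
`∑_{A ∈ M} ker(A - Mo)` is all of `H` is an extreme point of `𝔏(M)`. -/
theorem stmt10 (M : Set (H →L[ℂ] H)) (hne : M.Nonempty)
    (hsa : ∀ A ∈ M, IsSelfAdjoint A)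
    (hbdd : (lowerBoundsSA M).Nonempty) :
    (∀ L ∈ lowerBoundsSA M,
      (∀ L₁ ∈ lowerBoundsSA M, ∀ L₂ ∈ lowerBoundsSA M,
        L = (1 / 2 : ℝ) • (L₁ + L₂) → L₁ = L₂) →
      IsMaximalSA (lowerBoundsSA M) L) ∧
    (∀ Mo, IsMaximalSA (lowerBoundsSA M) Mo →
      (⨆ A ∈ M, LinearMap.ker ((A - Mo : H →L[ℂ] H) : H →ₗ[ℂ] H)).topologicalClosure = ⊤ →
      ∀ L₁ ∈ lowerBoundsSA M, ∀ L₂ ∈ lowerBoundsSA M,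
        Mo = (1 / 2 : ℝ) • (L₁ + L₂) → L₁ = L₂) := by
  constructor
  · intro L hL hext
    refine ⟨hL, fun X hX hLX => ?_⟩
    have h := hext X hX (L + L - X) ⟨(hL.1.add hL.1).sub hX.1, fun A hA u => ?_⟩ ?_
    · ext u
      have hu := congrArg (fun T : H →L[ℂ] H => T u) h
      simp only [ContinuousLinearMap.sub_apply, ContinuousLinearMap.add_apply] at hu
      have h2 : (2 : ℂ) • X u = (2 : ℂ) • L u := by
        rw [two_smul, two_smul]
        nth_rewrite 1 [hu]
        abel
      exact smul_right_injective H (two_ne_zero : (2 : ℂ) ≠ 0) h2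
    · have h1 := hL.2 A hA u
      have h2 := hLX u
      have h3 : qform (L + L - X) u = qform L u + qform L u - qform X u := by
        simp [qform, inner_sub_left, inner_add_left]
      linarith
    · rw [add_sub_cancel, ← two_smul ℝ L, smul_smul]
      norm_num
  · intro Mo _ hcl L₁ h₁ L₂ h₂ hMo
    have hsum : L₁ + L₂ = Mo + Mo := by
      rw [hMo, ← two_smul ℝ ((1 / 2 : ℝ) • (L₁ + L₂)), smul_smul]
      norm_num
    have hle : (⨆ A ∈ M, LinearMap.ker ((A - Mo : H →L[ℂ] H) : H →ₗ[ℂ] H))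
        ≤ LinearMap.ker ((L₁ - L₂ : H →L[ℂ] H) : H →ₗ[ℂ] H) := by
      refine iSup₂_le fun A hA u hu => ?_
      have hu' : A u = Mo u := by
        have : A u - Mo u = 0 := by simpa using hu
        exact sub_eq_zero.mp this
      have hq : qform L₁ u + qform L₂ u = qform A u + qform A u := by
        have hs := congrArg (fun T : H →L[ℂ] H => qform T u) hsum
        simp only [qform, ContinuousLinearMap.add_apply, inner_add_left, Complex.add_re] at hs
        simp only [qform, hu', hs]
      have e₁ := h₁.2 A hA u
      have e₂ := h₂.2 A hA u
      have z₁ := apply_eq_zero_of_qform (A - L₁) ((hsa A hA).sub h₁.1)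
        (fun v => by rw [qform_sub]; linarith [h₁.2 A hA v]) u (by rw [qform_sub]; linarith)
      have z₂ := apply_eq_zero_of_qform (A - L₂) ((hsa A hA).sub h₂.1)
        (fun v => by rw [qform_sub]; linarith [h₂.2 A hA v]) u (by rw [qform_sub]; linarith)
      have w₁ : A u = L₁ u := sub_eq_zero.mp z₁
      have w₂ : A u = L₂ u := sub_eq_zero.mp z₂
      have : L₁ u - L₂ u = 0 := by rw [← w₁, ← w₂, sub_self]
      simpa using this
    have htop := Submodule.topologicalClosure_minimal _ hle
      (ContinuousLinearMap.isClosed_ker (L₁ - L₂))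
    rw [hcl] at htop
    ext u
    have hu : (L₁ - L₂) u = 0 := htop (Submodule.mem_top (x := u))
    exact sub_eq_zero.mp hu
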